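/- arXiv:2110.12420 — 2 statements merged into one kernel-verified Lean document; each statement's English description precedes it below -/
import Mathlib

section
/- Let 1 < p < ∞ and N ∈ ℕ. There exists a constant C > 0 depending only on p such that for all vectors a, b ∈ ℝ^N one has ⟨‖a‖^{p-2}·a − ‖b‖^{p-2}·b, a − b⟩ ≥ C (‖a‖ + ‖b‖)^{p-2} ‖a − b‖². -/
open scoped RealInnerProductSpace

/-- A lower bound for the increments of `t ↦ t ^ (p - 1)` on the nonnegative half-line. -/
lemma min_mul_rpow_mul_sub_le {p x y : ℝ} (hp : 1 < p) (hx : 0 < x) (hy : 0 ≤ y) (hyx : y ≤ x) :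
    min (p - 1) 1 * x ^ (p - 2) * (x - y) ≤ x ^ (p - 2) * x - y ^ (p - 2) * y := by
  have hA : 0 < x ^ (p - 2) := Real.rpow_pos_of_pos hx _
  rcases le_total 2 p with h2 | h2
  · have hB : y ^ (p - 2) ≤ x ^ (p - 2) := Real.rpow_le_rpow hy hyx (by linarith)
    have h1 : min (p - 1) 1 * (x ^ (p - 2) * (x - y)) ≤ 1 * (x ^ (p - 2) * (x - y)) :=
      mul_le_mul_of_nonneg_right (min_le_right _ _) (mul_nonneg hA.le (by linarith))
    nlinarith [mul_le_mul_of_nonneg_right hB hy]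
  · have h1 : min (p - 1) 1 * (x ^ (p - 2) * (x - y)) ≤ (p - 1) * (x ^ (p - 2) * (x - y)) :=
      mul_le_mul_of_nonneg_right (min_le_left _ _) (mul_nonneg hA.le (by linarith))
    have hbern := rpow_one_add_le_one_add_mul_self (s := y / x - 1) (p := p - 1)
      (by linarith [div_nonneg hy hx.le]) (by linarith) (by linarith)
    rw [add_sub_cancel, Real.div_rpow hy hx.le, div_le_iff₀ (Real.rpow_pos_of_pos hx _)] at hbern
    have hxp : x ^ (p - 1) = x ^ (p - 2) * x := by
      rw [← Real.rpow_add_one hx.ne']; ring_nf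
    have hyp : y ^ (p - 1) = y ^ (p - 2) * y := by
      rw [← Real.rpow_add_one' hy (by linarith)]; ring_nf
    rw [hxp, hyp] at hbern
    have e : (1 + (p - 1) * (y / x - 1)) * (x ^ (p - 2) * x)
        = x ^ (p - 2) * x + (p - 1) * (x ^ (p - 2) * (y - x)) := by
      field_simp
    linarith

lemma two_rpow_mul_add_rpow_mul_add_le {p x y : ℝ} (hp : 1 < p) (hx : 0 < x) (hy : 0 ≤ y)
    (hyx : y ≤ x) : 2 ^ (1 - p) * (x + y) ^ (p - 2) * (x + y) ≤ x ^ (p - 2) * x := by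
  have hxy : 0 < x + y := by linarith
  rw [mul_assoc, ← Real.rpow_add_one hxy.ne', ← Real.rpow_add_one hx.ne',
    show p - 2 + 1 = p - 1 by ring, show 1 - p = -(p - 1) by ring, Real.rpow_neg zero_le_two,
    inv_mul_le_iff₀ (Real.rpow_pos_of_pos two_pos _), ← Real.mul_rpow zero_le_two hx.le]
  exact Real.rpow_le_rpow hxy.le (by linarith) (by linarith)

/-- An affine function that is nonnegative at `t` and `-t` is nonnegative in between. -/
lemma mul_le_of_abs_le {u v s t : ℝ} (hs : |s| ≤ t) (h₁ : v * t ≤ u) (h₂ : -(v * t) ≤ u) :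
    v * s ≤ u := by
  have h : |v| * |s| ≤ |v| * t := mul_le_mul_of_nonneg_left hs (abs_nonneg v)
  rw [← abs_mul] at h
  have h' := le_abs_self (v * s)
  rcases abs_cases v with ⟨hv, -⟩ | ⟨hv, -⟩ <;> rw [hv] at h <;> linarith

lemma plaplace_monotonicity_of_norm_le {E : Type*} [NormedAddCommGroup E] [InnerProductSpace ℝ E]
    {p : ℝ} (hp : 1 < p) {a b : E} (hba : ‖b‖ ≤ ‖a‖) :
    min (p - 1) 1 * 2 ^ (1 - p) * (‖a‖ + ‖b‖) ^ (p - 2) * ‖a - b‖ ^ 2 ≤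
      ⟪(‖a‖ ^ (p - 2) : ℝ) • a - (‖b‖ ^ (p - 2) : ℝ) • b, a - b⟫ := by
  rcases (norm_nonneg a).eq_or_lt with ha | ha
  · have ha0 : a = 0 := norm_eq_zero.mp ha.symm
    have hb0 : b = 0 := norm_le_zero_iff.mp (hba.trans ha.ge)
    simp [ha0, hb0]
  have hb := norm_nonneg b
  have hinc := min_mul_rpow_mul_sub_le hp ha hb hba
  have hsum := two_rpow_mul_add_rpow_mul_add_le hp ha hb hba
  have hcs := abs_real_inner_le_norm a b
  have hm : 0 < min (p - 1) 1 := lt_min (by linarith) one_pos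
  have hm1 : min (p - 1) 1 ≤ 1 := min_le_right _ _
  have hA : 0 < ‖a‖ ^ (p - 2) := Real.rpow_pos_of_pos ha _
  have hB : 0 ≤ ‖b‖ ^ (p - 2) := Real.rpow_nonneg hb _
  have hS : 0 < 2 ^ (1 - p) * (‖a‖ + ‖b‖) ^ (p - 2) := by positivity
  rw [norm_sub_sq_real, mul_assoc (min (p - 1) 1)]
  simp only [inner_sub_left, inner_sub_right, real_inner_smul_left, real_inner_self_eq_norm_sq,
    real_inner_comm a b]
  generalize 2 ^ (1 - p) * (‖a‖ + ‖b‖) ^ (p - 2) = T at *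
  generalize ‖a‖ ^ (p - 2) = A at *
  generalize ‖b‖ ^ (p - 2) = B at *
  generalize min (p - 1) 1 = m at *
  generalize ‖a‖ = x at *
  generalize ‖b‖ = y at *
  have hTA : T ≤ A := le_of_mul_le_mul_right (by nlinarith) ha
  have hpar : m * T * (x - y) ^ 2 ≤ (A * x - B * y) * (x - y) := by
    have h₁ := mul_le_mul_of_nonneg_right hinc (sub_nonneg.mpr hba)
    have h₂ := mul_le_mul_of_nonneg_right (mul_le_mul_of_nonneg_left hTA hm.le)
      (sq_nonneg (x - y))
    linarith
  have hanti : m * T * (x + y) ^ 2 ≤ (A * x + B * y) * (x + y) := by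
    have h₁ : m * (T * (x + y)) ≤ T * (x + y) := mul_le_of_le_one_left (by positivity) hm1
    have h₂ : m * (T * (x + y)) ≤ A * x + B * y := by linarith [mul_nonneg hB hb]
    linarith [mul_le_mul_of_nonneg_right h₂ (add_nonneg ha.le hb)]
  have := mul_le_of_abs_le (u := A * x ^ 2 + B * y ^ 2 - m * T * (x ^ 2 + y ^ 2))
    (v := A + B - 2 * (m * T)) hcs (by linarith) (by linarith)
  linarith

/-- For `1 < p < ∞` there exists `C > 0`, depending only on `p`, such that for all
vectors `a, b ∈ ℝ^N` one has
`⟨‖a‖^(p-2) a − ‖b‖^(p-2) b, a − b⟩ ≥ C (‖a‖ + ‖b‖)^(p-2) ‖a − b‖²`. -/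
theorem plaplace_monotonicity (p : ℝ) (hp : 1 < p) :
    ∃ C : ℝ, 0 < C ∧ ∀ (N : ℕ) (a b : EuclideanSpace ℝ (Fin N)),
      C * (‖a‖ + ‖b‖) ^ (p - 2) * ‖a - b‖ ^ 2 ≤
        ⟪(‖a‖ ^ (p - 2) : ℝ) • a - (‖b‖ ^ (p - 2) : ℝ) • b, a - b⟫ := by
  have hm : 0 < min (p - 1) 1 := lt_min (by linarith) one_pos
  refine ⟨min (p - 1) 1 * 2 ^ (1 - p), by positivity, fun N a b => ?_⟩
  rcases le_total ‖b‖ ‖a‖ with h | h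
  · exact plaplace_monotonicity_of_norm_le hp h
  · have key := plaplace_monotonicity_of_norm_le hp h
    rwa [← inner_neg_neg, neg_sub, neg_sub, norm_sub_rev, add_comm ‖b‖] at key
end

section
/- Let X be a real normed vector space, let p > 1 and 0 < δ < 1, and let G : X → ℝ satisfy G(v) ≥ 0 for all v and G(t·v) = t^{1−δ} G(v) for all t ≥ 0 and v ∈ X. Suppose u ∈ X satisfies u ≠ 0, ‖u‖^p = G(u), and (1/p)‖u‖^p − (1/(1−δ))G(u) ≤ (1/p)‖v‖^p − (1/(1−δ))G(v) for all v ∈ X. Then the infimum μ := inf{‖v‖^p : v ∈ X, G(v) = 1} satisfies μ = ‖u‖^{p(1−δ−p)/(1−δ)}, and this infimum is attained at U = G(u)^{−1/(1−δ)}·u, i.e. G(U) = 1 and ‖U‖^p = ‖u‖^{p(1−δ−p)/(1−δ)}. -/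
/-- Abstract form of the best-constant identification: if `G ≥ 0` is `(1-δ)`-homogeneous,
`u ≠ 0` satisfies `‖u‖^p = G u` and minimizes `J(v) = (1/p)‖v‖^p − (1/(1-δ)) G v`, then
`inf {‖v‖^p : G v = 1} = ‖u‖^(p(1-δ-p)/(1-δ))`, attained at `U = G(u)^(−1/(1−δ)) • u`. -/
theorem best_constant_from_minimizer (X : Type*) [NormedAddCommGroup X]
    [NormedSpace ℝ X] (p δ : ℝ) (hp : 1 < p) (hδ0 : 0 < δ) (hδ1 : δ < 1)
    (G : X → ℝ) (hG0 : ∀ v, 0 ≤ G v)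
    (hGhom : ∀ (t : ℝ) (v : X), 0 ≤ t → G (t • v) = t ^ (1 - δ) * G v)
    (u : X) (hu : u ≠ 0) (huG : ‖u‖ ^ p = G u)
    (hmin : ∀ v : X, (1 / p) * ‖u‖ ^ p - (1 / (1 - δ)) * G u ≤
      (1 / p) * ‖v‖ ^ p - (1 / (1 - δ)) * G v) :
    sInf {c : ℝ | ∃ v : X, G v = 1 ∧ c = ‖v‖ ^ p} =
        ‖u‖ ^ (p * (1 - δ - p) / (1 - δ)) ∧
      G ((G u ^ (-(1 / (1 - δ))) : ℝ) • u) = 1 ∧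
      ‖(G u ^ (-(1 / (1 - δ))) : ℝ) • u‖ ^ p = ‖u‖ ^ (p * (1 - δ - p) / (1 - δ)) := by
  have hs : 0 < 1 - δ := by linarith
  have hps : 0 < p - (1 - δ) := by linarith
  have ha : 0 < ‖u‖ := norm_pos_iff.mpr hu
  have hGu : 0 < G u := huG ▸ Real.rpow_pos_of_pos ha p
  have hGU : G ((G u ^ (-(1 / (1 - δ))) : ℝ) • u) = 1 := by
    rw [hGhom _ _ (by positivity), ← Real.rpow_mul hGu.le,
      show -(1 / (1 - δ)) * (1 - δ) = -1 by field_simp, Real.rpow_neg_one,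
      inv_mul_cancel₀ hGu.ne']
  have hnU : ‖(G u ^ (-(1 / (1 - δ))) : ℝ) • u‖ ^ p =
      ‖u‖ ^ (p * (1 - δ - p) / (1 - δ)) := by
    rw [norm_smul, Real.norm_of_nonneg (by positivity), ← huG,
      Real.mul_rpow (by positivity) ha.le, ← Real.rpow_mul ha.le, ← Real.rpow_mul ha.le,
      ← Real.rpow_add ha]
    congr 1
    field_simp
    ring
  refine ⟨IsLeast.csInf_eq ⟨⟨_, hGU, hnU.symm⟩, ?_⟩, hGU, hnU⟩
  rintro _ ⟨v, hv, rfl⟩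
  have hb : 0 < ‖v‖ := by
    refine norm_pos_iff.mpr fun h => ?_
    have h0 := hGhom 0 v le_rfl
    rw [zero_smul, Real.zero_rpow hs.ne', zero_mul, ← h, hv] at h0
    exact one_ne_zero h0
  have hle : ‖v‖ ^ (-(p * (1 - δ) / (p - (1 - δ)))) ≤ ‖u‖ ^ p := by
    have h := hmin (‖v‖ ^ (-(p / (p - (1 - δ)))) • v)
    rw [hGhom _ _ (by positivity), norm_smul, Real.norm_of_nonneg (by positivity), hv, ← huG,
      Real.mul_rpow (by positivity) hb.le, ← Real.rpow_mul hb.le, ← Real.rpow_mul hb.le,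
      ← Real.rpow_add hb,
      show -(p / (p - (1 - δ))) * p + p = -(p * (1 - δ) / (p - (1 - δ))) by
        field_simp
        ring,
      show -(p / (p - (1 - δ))) * (1 - δ) = -(p * (1 - δ) / (p - (1 - δ))) by ring] at h
    have hcoeff : 1 / p < 1 / (1 - δ) := one_div_lt_one_div_of_lt hs (by linarith)
    refine le_of_mul_le_mul_left ?_ (sub_pos.mpr hcoeff)
    linarith
  have hpow := Real.rpow_le_rpow_of_nonpos (by positivity) hle
    (show -((p - (1 - δ)) / (1 - δ)) ≤ 0 from neg_nonpos.mpr (by positivity))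
  rwa [← Real.rpow_mul ha.le, ← Real.rpow_mul hb.le,
    show p * -((p - (1 - δ)) / (1 - δ)) = p * (1 - δ - p) / (1 - δ) by ring,
    show -(p * (1 - δ) / (p - (1 - δ))) * -((p - (1 - δ)) / (1 - δ)) = p by
      rw [neg_mul_neg, div_mul_div_cancel₀ hps.ne', mul_div_cancel_right₀ _ hs.ne']] at hpow
end
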